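/- Let G and H be countable discrete groups equipped with proper left-invariant metrics. Suppose G has finite asymptotic dimension and has the (m,0)-DTUT property for some m ∈ ℕ, and H is an FC-group with asymptotic dimension asdim(H) < ∞. Let W be a wreath-like product of G and H corresponding to an action H ↷ I with finitely many orbits, i.e. W fits into an extension 1 → ⊕_{i∈I} G_i → W →^ε H → 1 with each G_i ≅ G and w G_i w^{-1} = G_{ε(w).i} for all w ∈ W and i ∈ I. Suppose there exists a symmetric transversal T for ⊕_{i∈I} G_i in W whose transversal map η : H → T is unital and bornologous (with respect to d_H and a proper left-invariant metric d_W on W associated with T). Then the transfinite asymptotic dimension of W satisfies trasdim(W) ≤ ω·m + asdim(H). -/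

import Mathlib

open Metric Set Function

namespace APC

variable {X Y : Type*}

/-- A family `𝒰` of subsets of a metric space is `r`-disjoint if any two distinct members
are at distance at least `r`. -/
def RDisjoint [MetricSpace X] (r : ℝ) (𝒰 : Set (Set X)) : Prop :=
  ∀ U ∈ 𝒰, ∀ V ∈ 𝒰, U ≠ V → ∀ x ∈ U, ∀ y ∈ V, r ≤ dist x y

/-- A family `𝒰` is `R`-bounded if every member has diameter at most `R`. -/
def RBounded [MetricSpace X] (R : ℝ) (𝒰 : Set (Set X)) : Prop :=
  ∀ U ∈ 𝒰, ∀ x ∈ U, ∀ y ∈ U, dist x y ≤ R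

/-- A family is uniformly bounded if it is `R`-bounded for some `R > 0`. -/
def UnifBounded [MetricSpace X] (𝒰 : Set (Set X)) : Prop :=
  ∃ R : ℝ, 0 < R ∧ RBounded R 𝒰

/-- `asdim X ≤ n`. -/
def AsdimLE (X : Type*) [MetricSpace X] (n : ℕ) : Prop :=
  ∀ r : ℝ, 0 < r → ∃ 𝒰 : Fin (n + 1) → Set (Set X),
    (∀ i, UnifBounded (𝒰 i)) ∧ (∀ i, RDisjoint r (𝒰 i)) ∧ (⋃ i, ⋃₀ 𝒰 i) = Set.univ

/-- `X` has finite asymptotic dimension. -/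
def HasFiniteAsdim (X : Type*) [MetricSpace X] : Prop := ∃ n : ℕ, AsdimLE X n

/-- Asymptotic property C. -/
def HasAPC (X : Type*) [MetricSpace X] : Prop :=
  ∀ R : ℕ → ℝ, (∀ i, 0 < R i) → StrictMono R →
    ∃ n : ℕ, ∃ 𝒰 : Fin (n + 1) → Set (Set X),
      (∀ i, UnifBounded (𝒰 i)) ∧ (∀ i : Fin (n + 1), RDisjoint (R i) (𝒰 i)) ∧
      (⋃ i, ⋃₀ 𝒰 i) = Set.univ

/-- `M^a`, the derivative of a collection of finite nonempty subsets of `ℕ`. -/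
def deriv (M : Set (Finset ℕ)) (a : ℕ) : Set (Finset ℕ) :=
  {τ | τ.Nonempty ∧ a ∉ τ ∧ insert a τ ∈ M}

/-- `OrdLE α M` means `Ord M ≤ α` in the sense of Radul: either `M = ∅`
(so that `Ord M = 0`), or `Ord M^a < α` for every `a : ℕ`.  Defined by
well-founded recursion on the ordinal `α`. -/
def OrdLE : Ordinal.{0} → Set (Finset ℕ) → Prop :=
  Ordinal.lt_wf.fix (C := fun _ => Set (Finset ℕ) → Prop)
    (fun α IH M => M = ∅ ∨ ∀ a : ℕ, ∃ β : Ordinal.{0}, ∃ hβ : β < α, IH β hβ (deriv M a))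

/-- The collection `A(X,d)` of finite nonempty subsets `σ ⊆ ℕ` such that there is no
covering of `X` by uniformly bounded families `𝒰ᵢ` (`i ∈ σ`), each `i`-disjoint. -/
def AClass (X : Type*) [MetricSpace X] : Set (Finset ℕ) :=
  {σ | σ.Nonempty ∧ ¬ ∃ 𝒰 : ℕ → Set (Set X),
      (∀ i ∈ σ, UnifBounded (𝒰 i)) ∧ (∀ i ∈ σ, RDisjoint (i : ℝ) (𝒰 i)) ∧
      (⋃ i ∈ σ, ⋃₀ 𝒰 i) = Set.univ}

/-- `trasdim X ≤ α`. -/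
def TrasdimLE (X : Type*) [MetricSpace X] (α : Ordinal.{0}) : Prop :=
  OrdLE α (AClass X)

/-- The `(m,n)`-DTUT property: disjointness of the `(m,n)`-tiling through uniform
translation. -/
def DTUT (X : Type*) [MetricSpace X] (m n : ℕ) : Prop :=
  ∃ F : Fin m → ℕ,
    ∀ h : ℕ+ → ℕ+, ∀ k : Fin (m + 1) → ℕ+, StrictMono k →
      ∃ C : (Fin m → ℕ+) → Fin (n + 1) → Set (Set X),
      ∃ D : (Fin m → ℕ+) → (i : Fin m) → Fin (F i + 1) → Set (Set X),
        ∀ l : Fin m → ℕ+, (∀ r : Fin m, l r ≤ h (k r.succ)) →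
          ((∀ j, UnifBounded (C l j)) ∧
           (∀ i s, UnifBounded (D l i s)) ∧
           (∀ j, RDisjoint ((k 0 : ℕ) : ℝ) (C l j)) ∧
           (∀ (i : Fin m) (s : Fin (F i + 1)), RDisjoint ((k i.succ : ℕ) : ℝ) (D l i s)) ∧
           ((⋃ j, ⋃₀ C l j) ∪ (⋃ i, ⋃ s, ⋃₀ D l i s) = Set.univ)) ∧
          (∀ (i : Fin m) (s : Fin (F i + 1)),
            (∀ t : ℕ+, t ≤ h (k i.succ) →
              (⋃₀ D (Function.update l i t) i s).Nonempty) ∧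
            (∀ t t' : ℕ+, t ≤ h (k i.succ) → t' ≤ h (k i.succ) → t ≠ t' →
              Disjoint (⋃₀ D (Function.update l i t) i s)
                (⋃₀ D (Function.update l i t') i s)) ∧
            RDisjoint ((k i.succ : ℕ) : ℝ)
              (⋃ t ∈ {t : ℕ+ | t ≤ h (k i.succ)}, D (Function.update l i t) i s))

/-- The word length of `g` with respect to the symmetrized generating set `S ∪ S⁻¹`. -/
noncomputable def wordLength {G : Type*} [Group G] (S : Set G) (g : G) : ℕ :=
  sInf {n : ℕ | ∃ L : List G, (∀ x ∈ L, x ∈ S ∨ x⁻¹ ∈ S) ∧ L.prod = g ∧ L.length = n}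

/-- A group is FC if every conjugacy class is finite. -/
def IsFCGroup (G : Type*) [Group G] : Prop :=
  ∀ x : G, Set.Finite {y : G | ∃ g : G, g * x * g⁻¹ = y}

/-- A metric on a countable discrete space is proper if every ball is finite. -/
def ProperMet (X : Type*) [MetricSpace X] : Prop :=
  ∀ (x : X) (R : ℝ), (Metric.closedBall x R).Finite

/-- Left invariance of a metric on a group. -/
def LeftInvariant (G : Type*) [Group G] [MetricSpace G] : Prop :=
  ∀ g x y : G, dist (g * x) (g * y) = dist x y

/-- Bornologous maps. -/
def Bornologous [MetricSpace X] [MetricSpace Y] (f : X → Y) : Prop :=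
  ∀ R : ℝ, 0 < R → ∃ P : ℝ, 0 < P ∧ ∀ x y : X, dist x y < R → dist (f x) (f y) < P

/-- Coarse embeddings. -/
def CoarseEmbedding [MetricSpace X] [MetricSpace Y] (f : X → Y) : Prop :=
  ∃ ρminus ρplus : ℝ → ℝ, Monotone ρminus ∧ Monotone ρplus ∧
    Filter.Tendsto ρminus Filter.atTop Filter.atTop ∧
    (∀ x y : X, ρminus (dist x y) ≤ dist (f x) (f y) ∧ dist (f x) (f y) ≤ ρplus (dist x y))

/-- Coarse equivalences: coarse embeddings with coarsely dense image. -/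
def CoarseEquiv [MetricSpace X] [MetricSpace Y] (f : X → Y) : Prop :=
  CoarseEmbedding f ∧ ∃ C : ℝ, 0 < C ∧ ∀ y : Y, ∃ x : X, dist y (f x) ≤ C

end APC

namespace APC

/-- The subgroup of finitely supported functions `I → G`, i.e. the restricted direct
product `⊕_{i ∈ I} G`. -/
def finSuppSubgroup (I G : Type*) [Group G] : Subgroup (I → G) where
  carrier := {f | (Function.mulSupport f).Finite}
  one_mem' := by
    simp [Function.mulSupport_one]
  mul_mem' := by
    intro a b ha hb
    refine (ha.union hb).subset fun x hx => ?_
    by_contra hc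
    simp only [Set.mem_union, Function.mem_mulSupport, not_or, not_not] at hc
    exact (Function.mem_mulSupport.mp hx) (by rw [Pi.mul_apply, hc.1, hc.2, one_mul])
  inv_mem' := by
    intro a ha
    refine ha.subset fun x hx => ?_
    have := Function.mem_mulSupport.mp hx
    rw [Pi.inv_apply, ne_eq, inv_eq_one] at this
    exact Function.mem_mulSupport.mpr this

end APC

namespace APC

theorem ordLE_iff (α : Ordinal.{0}) (M : Set (Finset ℕ)) :
    OrdLE α M ↔ M = ∅ ∨ ∀ a : ℕ, ∃ β : Ordinal.{0}, β < α ∧ OrdLE β (deriv M a) := by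
  unfold OrdLE
  rw [WellFounded.fix_eq]
  simp only [exists_prop]

theorem ordLE_empty (α : Ordinal.{0}) : OrdLE α ∅ :=
  (ordLE_iff _ _).2 (Or.inl rfl)

/-- The derivative of `M` with respect to a finite set `σ`. -/
def relDeriv (M : Set (Finset ℕ)) (σ : Finset ℕ) : Set (Finset ℕ) :=
  {τ | τ.Nonempty ∧ Disjoint σ τ ∧ σ ∪ τ ∈ M}

theorem deriv_relDeriv_of_notMem {M : Set (Finset ℕ)} {σ : Finset ℕ} {a : ℕ} (ha : a ∉ σ) :
    deriv (relDeriv M σ) a = relDeriv M (insert a σ) := by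
  ext τ
  simp only [deriv, relDeriv, Set.mem_ofPred_eq, Finset.insert_nonempty, true_and,
    Finset.disjoint_insert_right, Finset.disjoint_insert_left, Finset.insert_union,
    Finset.union_insert]
  tauto

theorem deriv_relDeriv_of_mem {M : Set (Finset ℕ)} {σ : Finset ℕ} {a : ℕ} (ha : a ∈ σ) :
    deriv (relDeriv M σ) a = ∅ := by
  ext τ
  simp [deriv, relDeriv, Finset.disjoint_insert_right, ha]

theorem ordLE_add_natCast {M : Set (Finset ℕ)} {α : Ordinal.{0}} (k : ℕ) :
    ∀ σ : Finset ℕ,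
      (∀ τ : Finset ℕ, τ.card = k → Disjoint σ τ → OrdLE α (relDeriv M (σ ∪ τ))) →
      OrdLE (α + (k : Ordinal.{0})) (relDeriv M σ) := by
  induction k with
  | zero =>
    intro σ h
    simpa using h ∅ rfl (Finset.disjoint_empty_right _)
  | succ k ih =>
    intro σ h
    refine (ordLE_iff _ _).2 (Or.inr fun a => ⟨α + (k : Ordinal.{0}), ?_, ?_⟩)
    · gcongr
      exact_mod_cast Nat.lt_succ_self k
    · by_cases ha : a ∈ σ
      · rw [deriv_relDeriv_of_mem ha]
        exact ordLE_empty _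
      · rw [deriv_relDeriv_of_notMem ha]
        refine ih _ fun τ hτ hd => ?_
        rw [Finset.disjoint_insert_left] at hd
        have := h (insert a τ) (by rw [Finset.card_insert_of_notMem hd.1, hτ])
          (by rw [Finset.disjoint_insert_right]; exact ⟨ha, hd.2⟩)
        rwa [Finset.union_insert, ← Finset.insert_union] at this

theorem ordLE_omega_mul_succ_add {M : Set (Finset ℕ)} {σ : Finset ℕ} {j N : ℕ}
    (h : ∀ τ : Finset ℕ, τ.card = N + 1 → Disjoint σ τ → ∃ N' : ℕ,
      OrdLE (Ordinal.omega0 * (j : Ordinal.{0}) + (N' : Ordinal.{0})) (relDeriv M (σ ∪ τ))) :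
    OrdLE (Ordinal.omega0 * ((j + 1 : ℕ) : Ordinal.{0}) + (N : Ordinal.{0})) (relDeriv M σ) := by
  refine ordLE_add_natCast N σ fun τ hτ hd => (ordLE_iff _ _).2 (Or.inr fun a => ?_)
  have key : ∀ N' : ℕ, Ordinal.omega0 * (j : Ordinal.{0}) + (N' : Ordinal.{0}) <
      Ordinal.omega0 * ((j + 1 : ℕ) : Ordinal.{0}) := by
    intro N'
    rw [Nat.cast_succ, mul_add, mul_one]
    gcongr
    exact Ordinal.natCast_lt_omega0 N'
  by_cases ha : a ∈ σ ∪ τ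
  · rw [deriv_relDeriv_of_mem ha]
    exact ⟨_, key 0, ordLE_empty _⟩
  · rw [deriv_relDeriv_of_notMem ha]
    rw [Finset.mem_union, not_or] at ha
    obtain ⟨N', hN'⟩ := h (insert a τ) (by rw [Finset.card_insert_of_notMem ha.2, hτ])
      (by rw [Finset.disjoint_insert_right]; exact ⟨ha.1, hd⟩)
    rw [Finset.union_insert] at hN'
    exact ⟨_, key N', hN'⟩

theorem ordLE_natCast_relDeriv {M : Set (Finset ℕ)}
    (hM : ∀ σ ∈ M, ∀ σ' ⊆ σ, σ'.Nonempty → σ' ∈ M) {σ : Finset ℕ} {N : ℕ}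
    (h : ∀ τ : Finset ℕ, τ.card = N + 1 → Disjoint σ τ → σ ∪ τ ∉ M) :
    OrdLE (N : Ordinal.{0}) (relDeriv M σ) := by
  rw [← zero_add (N : Ordinal.{0})]
  refine ordLE_add_natCast N σ fun τ hτ hd => (ordLE_iff _ _).2 (Or.inl ?_)
  rw [Set.eq_empty_iff_forall_notMem]
  rintro ρ ⟨⟨c, hc⟩, hd', hρ⟩
  have hc' : c ∉ σ ∪ τ := fun hh => Finset.disjoint_left.1 hd' hh hc
  rw [Finset.mem_union, not_or] at hc'
  refine h (insert c τ) (by rw [Finset.card_insert_of_notMem hc'.2, hτ])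
    (by rw [Finset.disjoint_insert_right]; exact ⟨hc'.1, hd⟩)
    (hM _ hρ _ ?_ ⟨c, by simp⟩)
  rw [Finset.union_insert, Finset.insert_subset_iff]
  exact ⟨Finset.mem_union_right _ hc, Finset.subset_union_left⟩

/-- If, block by block, sets of prescribed sizes `N k r + 1` cannot all be put together inside
`M`, where the size of each block may depend on bounds `k` for the preceding blocks, then
`Ord M ≤ ω * m + n`. -/
theorem ordLE_of_blocks {M : Set (Finset ℕ)}
    (hM : ∀ σ ∈ M, ∀ σ' ⊆ σ, σ'.Nonempty → σ' ∈ M) (hne : ∀ σ ∈ M, σ.Nonempty) (m n : ℕ)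
    (N : (ℕ → ℕ) → ℕ → ℕ) (hN0 : ∀ k, N k 0 = n)
    (hN : ∀ k k' r, (∀ q < r, k q = k' q) → N k r = N k' r)
    (h : ∀ (k : ℕ → ℕ) (τ : ℕ → Finset ℕ),
      (∀ r ≤ m, (τ r).card = N k r + 1 ∧ ∀ a ∈ τ r, a ≤ k r) →
      (∀ r ≤ m, ∀ q < r, Disjoint (τ q) (τ r)) →
      (Finset.range (m + 1)).biUnion τ ∉ M) :
    OrdLE (Ordinal.omega0 * (m : Ordinal.{0}) + (n : Ordinal.{0})) M := by
  have main : ∀ j r : ℕ, r + j = m → ∀ (k : ℕ → ℕ) (τ : ℕ → Finset ℕ),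
      (∀ q < r, (τ q).card = N k q + 1 ∧ ∀ a ∈ τ q, a ≤ k q) →
      (∀ p < r, ∀ q < p, Disjoint (τ q) (τ p)) →
      OrdLE (Ordinal.omega0 * (j : Ordinal.{0}) + (N k r : Ordinal.{0}))
        (relDeriv M ((Finset.range r).biUnion τ)) := by
    have upd : ∀ (r : ℕ) (k : ℕ → ℕ) (τ : ℕ → Finset ℕ) (τ' : Finset ℕ),
        (∀ q < r, (τ q).card = N k q + 1 ∧ ∀ a ∈ τ q, a ≤ k q) →
        (∀ p < r, ∀ q < p, Disjoint (τ q) (τ p)) →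
        τ'.card = N k r + 1 → Disjoint ((Finset.range r).biUnion τ) τ' →
        (∀ q < r + 1, (update τ r τ' q).card = N (update k r (τ'.sup id)) q + 1 ∧
          ∀ a ∈ update τ r τ' q, a ≤ update k r (τ'.sup id) q) ∧
        (∀ p < r + 1, ∀ q < p, Disjoint (update τ r τ' q) (update τ r τ' p)) ∧
        (Finset.range (r + 1)).biUnion (update τ r τ') = (Finset.range r).biUnion τ ∪ τ' := by
      intro r k τ τ' h1 h2 h3 h4
      have hτ : ∀ q < r, update τ r τ' q = τ q := fun q hq => update_of_ne hq.ne _ _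
      have hk : ∀ q < r, update k r (τ'.sup id) q = k q := fun q hq => update_of_ne hq.ne _ _
      have hNk : ∀ q ≤ r, N (update k r (τ'.sup id)) q = N k q := fun q hq =>
        hN _ _ _ fun p hp => hk p (by omega)
      refine ⟨fun q hq => ?_, fun p hp q hq => ?_, ?_⟩
      · rcases Nat.lt_succ_iff_lt_or_eq.1 hq with hq | rfl
        · rw [hτ q hq, hk q hq, hNk q hq.le]
          exact h1 q hq
        · rw [update_self, update_self, hNk q le_rfl]
          exact ⟨h3, fun a ha => Finset.le_sup (f := id) ha⟩
      · rcases Nat.lt_succ_iff_lt_or_eq.1 hp with hp | rfl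
        · rw [hτ p hp, hτ q (hq.trans hp)]
          exact h2 p hp q hq
        · rw [hτ q hq, update_self]
          exact Finset.disjoint_of_subset_left
            (Finset.subset_biUnion_of_mem τ (Finset.mem_range.2 hq)) h4
      · rw [Finset.range_add_one, Finset.biUnion_insert, update_self, Finset.union_comm]
        congr 1
        exact Finset.biUnion_congr rfl fun q hq => hτ q (Finset.mem_range.1 hq)
    intro j
    induction j with
    | zero =>
      intro r hr k τ h1 h2
      obtain rfl : r = m := by omega
      simp only [Nat.cast_zero, mul_zero, zero_add]
      refine ordLE_natCast_relDeriv hM fun τ' hc hd => ?_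
      obtain ⟨h3, h4, h5⟩ := upd r k τ τ' h1 h2 hc hd
      rw [← h5]
      exact h _ _ (fun q hq => h3 q (by omega)) fun p hp => h4 p (by omega)
    | succ j ih =>
      intro r hr k τ h1 h2
      refine ordLE_omega_mul_succ_add fun τ' hc hd => ?_
      obtain ⟨h3, h4, h5⟩ := upd r k τ τ' h1 h2 hc hd
      rw [← h5]
      exact ⟨_, ih (r + 1) (by omega) _ _ h3 h4⟩
  have := main m 0 (by omega) (fun _ => 0) (fun _ => ∅) (by simp) (by simp)
  rw [hN0] at this
  convert this using 1
  ext τ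
  simp only [relDeriv, Finset.range_zero, Finset.biUnion_empty, Finset.disjoint_empty_left,
    Finset.empty_union, true_and, Set.mem_ofPred_eq]
  exact ⟨fun hτ => ⟨hne _ hτ, hτ⟩, fun hτ => hτ.2⟩

/-- `y` can be reached from `x` in one step in the set `A`, moving by an element of `P`. -/
def IsStep {Γ : Type*} [Group Γ] (A P : Set Γ) (x y : Γ) : Prop :=
  x ∈ A ∧ y ∈ A ∧ x⁻¹ * y ∈ P

/-- The `P`-components of `A` are uniformly bounded (contained in translates of a finite set). -/
def CompBounded {Γ : Type*} [Group Γ] (A P : Set Γ) : Prop :=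
  ∃ Q : Set Γ, Q.Finite ∧ ∀ x y, Relation.ReflTransGen (IsStep A P) x y → x⁻¹ * y ∈ Q

theorem compBounded_empty {Γ : Type*} [Group Γ] (P : Set Γ) : CompBounded (∅ : Set Γ) P := by
  refine ⟨{1}, Set.finite_singleton _, fun x y h => ?_⟩
  induction h with
  | refl => simp
  | tail _ h _ => exact absurd h.1 (Set.notMem_empty _)

theorem CompBounded.mono_set {Γ : Type*} [Group Γ] {A A' P : Set Γ} (h : CompBounded A' P)
    (hA : A ⊆ A') : CompBounded A P := by
  obtain ⟨Q, hQ, h⟩ := h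
  exact ⟨Q, hQ, fun x y hxy => h x y
    (hxy.lift id fun a b hab => ⟨hA hab.1, hA hab.2.1, hab.2.2⟩)⟩

theorem CompBounded.comap {Γ Γ' : Type*} [Group Γ] [Group Γ'] (f : Γ →* Γ')
    (hf : Injective f) {A' P' : Set Γ'} {P : Set Γ} (hP : ∀ x ∈ P, f x ∈ P')
    (h : CompBounded A' P') : CompBounded (f ⁻¹' A') P := by
  obtain ⟨Q, hQ, h⟩ := h
  refine ⟨f ⁻¹' Q, hQ.preimage hf.injOn, fun x y hxy => ?_⟩
  have := h (f x) (f y) (hxy.lift f fun a b hab =>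
    ⟨hab.1, hab.2.1, by rw [← map_inv, ← map_mul]; exact hP _ hab.2.2⟩)
  rwa [← map_inv, ← map_mul] at this

open scoped Pointwise in
theorem CompBounded.exists_union {Γ : Type*} [Group Γ] (S : Subgroup Γ) {A P : Set Γ}
    (hP : P.Finite) (hPS : P ⊆ S) (hA : CompBounded A P) :
    ∃ P' : Set Γ, P'.Finite ∧ P' ⊆ S ∧ ∀ B, CompBounded B P' → CompBounded (A ∪ B) P := by
  obtain ⟨Q, hQ, hAQ⟩ := hA
  have hS : ∀ x y, Relation.ReflTransGen (IsStep A P) x y → x⁻¹ * y ∈ S := by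
    intro x y h
    induction h with
    | refl => simp
    | tail _ h ih =>
      have := S.mul_mem ih (hPS h.2.2)
      simpa [mul_assoc] using this
  set Q₁ : Set Γ := Q ∩ S with hQ₁
  have hQ₁f : Q₁.Finite := hQ.inter_of_left _
  have hAQ₁ : ∀ x y, Relation.ReflTransGen (IsStep A P) x y → x⁻¹ * y ∈ Q₁ := fun x y h =>
    ⟨hAQ x y h, hS x y h⟩
  refine ⟨P ∪ P * Q₁ * P, hP.union ((hP.mul hQ₁f).mul hP), ?_, fun B hB => ?_⟩
  · rintro x (hx | hx)
    · exact hPS hx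
    · obtain ⟨_, ⟨p, hp, q, hq, rfl⟩, p', hp', rfl⟩ := hx
      exact S.mul_mem (S.mul_mem (hPS hp) hq.2) (hPS hp')
  obtain ⟨Z, hZ, hBZ⟩ := hB
  set P' := P ∪ P * Q₁ * P with hP'
  have key : ∀ x y, Relation.ReflTransGen (IsStep (A ∪ B) P) x y →
      Relation.ReflTransGen (IsStep A P) x y ∨
      ∃ c c', x⁻¹ * c ∈ (Q₁ * P ∪ {1} : Set Γ) ∧ c' ∈ B ∧
        Relation.ReflTransGen (IsStep B P') c c' ∧
        (y = c' ∨ y ∈ A ∧ ∃ a, c'⁻¹ * a ∈ P ∧ Relation.ReflTransGen (IsStep A P) a y) := by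
    intro x y h
    induction h with
    | refl => exact Or.inl .refl
    | @tail y z _ hyz ih =>
      obtain ⟨hy, hz, hyzP⟩ := hyz
      rcases ih with ih | ⟨c, c', h1, h2, h3, h4⟩
      · by_cases hzB : z ∈ B
        · refine Or.inr ⟨z, z, Or.inl ⟨x⁻¹ * y, hAQ₁ _ _ ih, y⁻¹ * z, hyzP, by group⟩, hzB,
            .refl, Or.inl rfl⟩
        have hzA : z ∈ A := hz.resolve_right hzB
        by_cases hyA : y ∈ A
        · exact Or.inl (ih.tail ⟨hyA, hzA, hyzP⟩)
        · have hxy : x = y := by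
            rcases Relation.ReflTransGen.cases_tail ih with h | ⟨_, _, h⟩
            · exact h.symm
            · exact absurd h.2.1 hyA
          subst hxy
          exact Or.inr ⟨x, x, Or.inr (by simp), hy.resolve_left hyA, .refl,
            Or.inr ⟨hzA, z, hyzP, .refl⟩⟩
      · by_cases hzB : z ∈ B
        · refine Or.inr ⟨c, z, h1, hzB, h3.tail ⟨h2, hzB, ?_⟩, Or.inl rfl⟩
          rcases h4 with rfl | ⟨_, a, ha, hay⟩
          · exact Or.inl hyzP
          · exact Or.inr ⟨_, ⟨_, ha, _, hAQ₁ _ _ hay, rfl⟩, _, hyzP, by group⟩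
        · have hzA : z ∈ A := hz.resolve_right hzB
          refine Or.inr ⟨c, c', h1, h2, h3, Or.inr ⟨hzA, ?_⟩⟩
          rcases h4 with rfl | ⟨hyA, a, ha, hay⟩
          · exact ⟨z, hyzP, .refl⟩
          · exact ⟨a, ha, hay.tail ⟨hyA, hzA, hyzP⟩⟩
  refine ⟨Q₁ ∪ (Q₁ * P ∪ {1}) * Z * ({1} ∪ P * Q₁), hQ₁f.union
    ((((hQ₁f.mul hP).union (Set.finite_singleton _)).mul hZ).mul
      ((Set.finite_singleton _).union (hP.mul hQ₁f))), fun x y hxy => ?_⟩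
  rcases key x y hxy with h | ⟨c, c', h1, -, h3, h4⟩
  · exact Or.inl (hAQ₁ _ _ h)
  · refine Or.inr ⟨_, ⟨_, h1, _, hBZ _ _ h3, rfl⟩, c'⁻¹ * y, ?_, by group⟩
    rcases h4 with rfl | ⟨_, a, ha, hay⟩
    · exact Or.inl (by simp)
    · exact Or.inr ⟨_, ha, _, hAQ₁ _ _ hay, by group⟩

theorem exists_compBounded_iUnion {Γ Λ 𝒯 Y : Type*} [Group Γ] [Finite Λ] (S : Y → Subgroup Γ)
    (P : Y → Set Γ) (hP : ∀ y, (P y).Finite) (hPS : ∀ y, P y ⊆ S y)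
    (E : Λ → 𝒯 → Y → Set Γ) (ok : Λ → 𝒯 → Prop)
    (h : ∀ (i : Λ) (P' : Y → Set Γ), (∀ y, (P' y).Finite) → (∀ y, P' y ⊆ S y) →
      ∃ t, ok i t ∧ ∀ y, CompBounded (E i t y) (P' y)) :
    ∃ T : Λ → 𝒯, (∀ i, ok i (T i)) ∧ ∀ y, CompBounded (⋃ i, E i (T i) y) (P y) := by
  classical
  have key : ∀ s : Finset Λ, ∃ T : Λ → 𝒯, (∀ i, ok i (T i)) ∧
      ∀ y, CompBounded (⋃ i ∈ s, E i (T i) y) (P y) := by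
    intro s
    induction s using Finset.induction_on with
    | empty =>
      choose T hT _ using fun i => h i (fun _ => ∅) (by simp) (by simp)
      exact ⟨T, hT, fun y => by simpa using compBounded_empty _⟩
    | insert i s hi ih =>
      obtain ⟨T, hT, hs⟩ := ih
      choose P' h1 h2 h3 using fun y => (hs y).exists_union (S y) (hP y) (hPS y)
      obtain ⟨t, ht, hE⟩ := h i P' h1 h2
      refine ⟨update T i t, fun j => ?_, fun y => (h3 y _ (hE y)).mono_set ?_⟩
      · by_cases hj : j = i
        · subst hj
          simpa using ht
        · simpa [hj] using hT j
      · intro x hx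
        simp only [Set.mem_iUnion, Finset.mem_insert] at hx
        obtain ⟨j, hj, hx⟩ := hx
        by_cases hji : j = i
        · subst hji
          exact Or.inr (by simpa using hx)
        · refine Or.inl (Set.mem_iUnion₂.2 ⟨j, hj.resolve_left hji, ?_⟩)
          simpa [hji] using hx
  cases nonempty_fintype Λ
  simpa using key Finset.univ

theorem LeftInvariant.dist_eq {G : Type*} [Group G] [MetricSpace G] (h : LeftInvariant G)
    (x y : G) : dist x y = dist 1 (x⁻¹ * y) := by
  rw [← h x⁻¹ x y, inv_mul_cancel]

theorem LeftInvariant.dist_one_mul_le {G : Type*} [Group G] [MetricSpace G]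
    (h : LeftInvariant G) (x y : G) : dist 1 (x * y) ≤ dist 1 x + dist 1 y := by
  have h1 := dist_triangle 1 x (x * y)
  rwa [h.dist_eq x (x * y), inv_mul_cancel_left] at h1

theorem LeftInvariant.dist_one_inv {G : Type*} [Group G] [MetricSpace G]
    (h : LeftInvariant G) (x : G) : dist 1 x⁻¹ = dist 1 x := by
  rw [dist_comm 1 x, h.dist_eq x 1, mul_one]

theorem ProperMet.finite_dist_one_le {G : Type*} [Group G] [MetricSpace G] (h : ProperMet G)
    (R : ℝ) : {x : G | dist 1 x ≤ R}.Finite := by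
  refine (h 1 R).subset fun x hx => ?_
  rw [Metric.mem_closedBall, dist_comm]
  exact hx

theorem exists_map_dist_le {W H : Type*} [Group W] [Group H] [MetricSpace W] [MetricSpace H]
    (hW : LeftInvariant W) (hWp : ProperMet W) (hH : LeftInvariant H) (ε : W →* H) (k : ℝ) :
    ∃ c : ℝ, 0 ≤ c ∧ ∀ w w' : W, dist w w' < k → dist (ε w) (ε w') ≤ c := by
  obtain ⟨c, hc⟩ := ((hWp.finite_dist_one_le k).image fun x => dist 1 (ε x)).bddAbove
  refine ⟨max c 0, le_max_right _ _, fun w w' h => le_max_of_le_left ?_⟩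
  rw [hH.dist_eq, ← map_inv, ← map_mul]
  refine hc ⟨w⁻¹ * w', ?_, rfl⟩
  rw [hW.dist_eq] at h
  exact h.le

/-- Families witnessing `asdim X ≤ n` at scale `r`, recorded as a colouring together with the
cell of each point. -/
theorem AsdimLE.exists_coloring {X : Type*} [MetricSpace X] {n : ℕ} (h : AsdimLE X n) (r : ℝ) :
    ∃ (col : X → Fin (n + 1)) (cell : X → Set X) (R : ℝ),
      (∀ x y, col x = col y → dist x y ≤ r → cell x = cell y) ∧
      ∀ x y, cell x = cell y → dist x y ≤ R := by
  obtain ⟨𝒰, h1, h2, h3⟩ := h (max r 0 + 1) (by positivity)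
  choose R hR0 hR using h1
  have hx : ∀ x : X, ∃ i, ∃ U ∈ 𝒰 i, x ∈ U := by
    intro x
    have : x ∈ ⋃ i, ⋃₀ 𝒰 i := h3 ▸ Set.mem_univ x
    simpa [Set.mem_iUnion, Set.mem_sUnion] using this
  choose col cell hcell hmem using hx
  refine ⟨col, cell, ∑ i, R i, fun x y hc hd => ?_, fun x y hc => ?_⟩
  · by_contra hne
    have := h2 (col x) (cell x) (hcell x) (cell y) (hc ▸ hcell y) hne x (hmem x) y (hmem y)
    linarith [le_max_left r 0]
  · exact (hR (col x) (cell x) (hcell x) x (hmem x) y (hc ▸ hmem y)).trans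
      (Finset.single_le_sum (fun i _ => (hR0 i).le) (Finset.mem_univ _))

/-- The data of a `(m,0)`-tiling indexed by vectors of labels in `L`, together with a colouring
by `d + 1` colours. -/
structure Tiling (G L : Type*) (m : ℕ) (F : Fin m → ℕ) (d : ℕ) where
  /-- the colouring of the space -/
  col : G → Fin (d + 1)
  /-- the set covered by the core family -/
  C : (Fin m → L) → Set G
  /-- the sets covered by the translated families -/
  D : (Fin m → L) → (r : Fin m) → Fin (F r + 1) → Set G

/-- The disjointness and boundedness requirements on a tiling at scale `ρ`. -/
structure Tiling.IsAt {G L : Type*} [MetricSpace G] {m : ℕ} {F : Fin m → ℕ} {d : ℕ}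
    (T : Tiling G L m F d) (ρ : ℝ) : Prop where
  cover : ∀ l x, x ∈ T.C l ∨ ∃ r s, x ∈ T.D l r s
  col_bdd : ∃ (cell : G → Set G) (R : ℝ),
    (∀ x y, T.col x = T.col y → dist x y ≤ ρ → cell x = cell y) ∧
    ∀ x y, cell x = cell y → dist x y ≤ R
  core_bdd : ∃ (cell : (Fin m → L) → G → Set G) (R : ℝ),
    (∀ l, ∀ x ∈ T.C l, ∀ y ∈ T.C l, dist x y ≤ ρ → cell l x = cell l y) ∧
    ∀ l, ∀ x ∈ T.C l, ∀ y ∈ T.C l, cell l x = cell l y → dist x y ≤ R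
  label_eq : ∀ l r s t t' x y, x ∈ T.D (update l r t) r s → y ∈ T.D (update l r t') r s →
    dist x y ≤ ρ → t = t'

theorem Tiling.IsAt.mono {G L : Type*} [MetricSpace G] {m : ℕ} {F : Fin m → ℕ} {d : ℕ}
    {T : Tiling G L m F d} {ρ ρ' : ℝ} (h : T.IsAt ρ') (hρ : ρ ≤ ρ') : T.IsAt ρ where
  cover := h.cover
  col_bdd := by
    obtain ⟨cell, R, h1, h2⟩ := h.col_bdd
    exact ⟨cell, R, fun x y hc hd => h1 x y hc (hd.trans hρ), h2⟩
  core_bdd := by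
    obtain ⟨cell, R, h1, h2⟩ := h.core_bdd
    exact ⟨cell, R, fun l x hx y hy hd => h1 l x hx y hy (hd.trans hρ), h2⟩
  label_eq l r s t t' x y hx hy hd := h.label_eq l r s t t' x y hx hy (hd.trans hρ)

theorem DTUT.exists_tiling {G : Type*} [MetricSpace G] {m : ℕ} (h : DTUT G m 0) {d : ℕ}
    (hd : AsdimLE G d) :
    ∃ F : Fin m → ℕ, ∀ (L : Type*) [Finite L] [Nonempty L] (ρ : ℝ),
      ∃ T : Tiling G L m F d, T.IsAt ρ := by
  obtain ⟨F, hF⟩ := h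
  refine ⟨F, fun L _ _ ρ => ?_⟩
  cases nonempty_fintype L
  obtain ⟨col, ccell, Rc, hc1, hc2⟩ := hd.exists_coloring ρ
  let e := Fintype.equivFin L
  let code : L → ℕ+ := fun t => ⟨e t + 1, Nat.succ_pos _⟩
  have hcode : Injective code := by
    intro t t' htt
    have : (e t : ℕ) + 1 = e t' + 1 := congrArg Subtype.val htt
    exact e.injective (Fin.ext (by omega))
  let hh : ℕ+ → ℕ+ := fun _ => ⟨Fintype.card L, Fintype.card_pos⟩
  have hle : ∀ t q, code t ≤ hh q := fun t q => (e t).isLt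
  let k : Fin (m + 1) → ℕ+ := fun r => ⟨⌈ρ⌉₊ + 1 + r, by omega⟩
  have hk : StrictMono k := by
    intro r r' hrr
    have : (r : ℕ) < r' := hrr
    change ⌈ρ⌉₊ + 1 + (r : ℕ) < ⌈ρ⌉₊ + 1 + (r' : ℕ)
    omega
  have hkρ : ∀ r, ρ < ((k r : ℕ) : ℝ) := by
    intro r
    have h1 := Nat.le_ceil ρ
    change ρ < ((⌈ρ⌉₊ + 1 + (r : ℕ) : ℕ) : ℝ)
    push_cast
    have : (0 : ℝ) ≤ (r : ℕ) := Nat.cast_nonneg _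
    linarith
  obtain ⟨C, D, hCD⟩ := hF hh k hk
  have hCD' := fun l : Fin m → L => hCD (fun r => code (l r)) fun r => hle _ (k r.succ)
  have hCR : ∀ l : Fin m → L, ∃ R : ℝ, 0 < R ∧ RBounded R (C (fun r => code (l r)) 0) :=
    fun l => (hCD' l).1.1 0
  choose R _ hR using hCR
  obtain ⟨R', hR'⟩ := Finite.exists_le R
  refine ⟨⟨col, fun l => ⋃₀ C (fun r => code (l r)) 0,
    fun l r s => ⋃₀ D (fun r => code (l r)) r s⟩, fun l x => ?_, ⟨ccell, Rc, hc1, hc2⟩, ?_, ?_⟩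
  · obtain ⟨-, -, -, -, hcov⟩ := (hCD' l).1
    have hx := Set.mem_univ x
    rw [← hcov] at hx
    rcases hx with hx | hx
    · obtain ⟨j, hj⟩ := Set.mem_iUnion.1 hx
      rw [Fin.fin_one_eq_zero j] at hj
      exact Or.inl hj
    · obtain ⟨r, hr⟩ := Set.mem_iUnion.1 hx
      obtain ⟨s, hs⟩ := Set.mem_iUnion.1 hr
      exact Or.inr ⟨r, s, hs⟩
  · have hcell : ∀ (l : Fin m → L) (x : G), ∃ U : Set G, x ∈ ⋃₀ C (fun r => code (l r)) 0 →
        U ∈ C (fun r => code (l r)) 0 ∧ x ∈ U := by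
      intro l x
      by_cases hx : x ∈ ⋃₀ C (fun r => code (l r)) 0
      · obtain ⟨U, hU⟩ := hx
        exact ⟨U, fun _ => hU⟩
      · exact ⟨∅, fun h => absurd h hx⟩
    choose cell hcell using hcell
    refine ⟨cell, R', fun l x hx y hy hxy => ?_, fun l x hx y hy hxy => ?_⟩
    · by_contra hne
      have := (hCD' l).1.2.2.1 0 _ (hcell l x hx).1 _ (hcell l y hy).1 hne x (hcell l x hx).2 y
        (hcell l y hy).2
      linarith [hkρ 0]
    · exact (hR l _ (hcell l x hx).1 x (hcell l x hx).2 y (hxy ▸ (hcell l y hy).2)).trans (hR' l)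
  · intro l r s t t' x y hx hy hxy
    have hupd : ∀ t, (fun q => code (update l r t q)) = update (fun q => code (l q)) r (code t) :=
      fun t => comp_update code l r t
    simp only [hupd] at hx hy
    obtain ⟨U, hU, hxU⟩ := hx
    obtain ⟨V, hV, hyV⟩ := hy
    obtain ⟨-, hdis, hRD⟩ := (hCD' l).2 r s
    have hUV : U = V := by
      by_contra hne
      have := hRD U (Set.mem_iUnion₂.2 ⟨code t, hle _ (k r.succ), hU⟩) V
        (Set.mem_iUnion₂.2 ⟨code t', hle _ (k r.succ), hV⟩) hne x hxU y hyV
      linarith [hkρ r.succ]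
    by_contra hne
    exact Set.disjoint_left.1 (hdis (code t) (code t') (hle _ (k r.succ)) (hle _ (k r.succ))
      (hcode.ne hne))
      ⟨U, hU, hxU⟩ ⟨V, hV, hUV ▸ hxU⟩

/-- Functions supported in `S` whose values have length at most `ρ`. -/
def box {I G : Type*} [Group G] [MetricSpace G] (S : Finset I) (ρ : ℝ) : Set (I → G) :=
  {g | (∀ j ∉ S, g j = 1) ∧ ∀ j ∈ S, dist 1 (g j) ≤ ρ}

theorem finite_box {I G : Type*} [Group G] [MetricSpace G] (hG : ProperMet G) (S : Finset I)
    (ρ : ℝ) : (box S ρ : Set (I → G)).Finite := by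
  classical
  have h1 : {f : S → G | ∀ i, f i ∈ {x : G | dist 1 x ≤ ρ}}.Finite :=
    Set.Finite.pi' fun _ => hG.finite_dist_one_le ρ
  refine (h1.image fun f j => if h : j ∈ S then f ⟨j, h⟩ else 1).subset fun g hg => ?_
  refine ⟨fun j => g j, fun j => hg.2 j j.2, ?_⟩
  ext j
  by_cases hj : j ∈ S
  · simp [hj]
  · simp [hj, hg.1 j hj]

theorem exists_subset_box {I G Γ : Type*} [Group G] [MetricSpace G] (f : Γ → I → G) {P : Set Γ}
    (hP : P.Finite) (S : Finset I) (h : ∀ x ∈ P, ∀ j ∉ S, f x j = 1) :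
    ∃ ρ : ℝ, ∀ x ∈ P, f x ∈ box S ρ := by
  obtain ⟨ρ, hρ⟩ := ((hP.prod S.finite_toSet).image fun p => dist 1 (f p.1 p.2)).bddAbove
  exact ⟨ρ, fun x hx => ⟨h x hx, fun j hj => hρ ⟨(x, j), ⟨hx, hj⟩, rfl⟩⟩⟩

theorem compBounded_box {I G Z : Type*} [Group G] [MetricSpace G] (hG : ProperMet G)
    (hGi : LeftInvariant G) {A : Set (I → G)} {S : Finset I} {ρ R : ℝ}
    (cell : I → (I → G) → Z)
    (h1 : ∀ x ∈ A, ∀ y ∈ A, x⁻¹ * y ∈ box S ρ → ∀ j ∈ S, cell j x = cell j y)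
    (h2 : ∀ x ∈ A, ∀ y ∈ A, ∀ j ∈ S, cell j x = cell j y → dist (x j) (y j) ≤ R) :
    CompBounded A (box S ρ) := by
  refine ⟨box S (max R 0), finite_box hG S _, fun x y h => ?_⟩
  have key : x = y ∨ x ∈ A ∧ y ∈ A ∧ (∀ j ∉ S, x j = y j) ∧ ∀ j ∈ S, cell j x = cell j y := by
    induction h with
    | refl => exact Or.inl rfl
    | @tail y z _ hyz ih =>
      have hc := h1 _ hyz.1 _ hyz.2.1 hyz.2.2
      have ho : ∀ j ∉ S, y j = z j := fun j hj => inv_mul_eq_one.1 (hyz.2.2.1 j hj)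
      rcases ih with rfl | ⟨hx, _, h3, h4⟩
      · exact Or.inr ⟨hyz.1, hyz.2.1, ho, hc⟩
      · exact Or.inr ⟨hx, hyz.2.1, fun j hj => (h3 j hj).trans (ho j hj),
          fun j hj => (h4 j hj).trans (hc j hj)⟩
  rcases key with rfl | ⟨hx, hy, h3, h4⟩
  · rw [inv_mul_cancel]
    exact ⟨fun _ _ => rfl, fun _ _ => by simp⟩
  · refine ⟨fun j hj => inv_mul_eq_one.2 (h3 j hj), fun j hj => ?_⟩
    have := h2 x hx y hy j hj (h4 j hj)
    rw [hGi.dist_eq] at this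
    exact this.trans (le_max_left _ _)

/-- The vector of labels of a function `x : I → G`: the `r`-th label records the colours of
the coordinates in `S (r + 1) \ S r`. -/
noncomputable def Tiling.label {G I : Type*} {m : ℕ} {F : Fin m → ℕ} {d : ℕ} (S : ℕ → Finset I)
    (T : Tiling G (S m → Fin (d + 1)) m F d) (x : I → G) : Fin m → S m → Fin (d + 1) :=
  open Classical in
  fun r j => if (j : I) ∈ S (r + 1) ∧ (j : I) ∉ S r then T.col (x j) else 0

theorem Tiling.label_congr {G I : Type*} {m : ℕ} {F : Fin m → ℕ} {d : ℕ} {S : ℕ → Finset I}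
    (T : Tiling G (S m → Fin (d + 1)) m F d) {x y : I → G} {r : Fin m}
    (h : ∀ j ∈ S (r + 1), j ∉ S r → T.col (x j) = T.col (y j)) :
    T.label S x r = T.label S y r := by
  ext1 j
  unfold Tiling.label
  split_ifs with hj
  · exact h j hj.1 hj.2
  · rfl

theorem Tiling.IsAt.compBounded_translated {G I : Type*} [Group G] [MetricSpace G]
    (hG : ProperMet G) (hGi : LeftInvariant G) {m : ℕ} {F : Fin m → ℕ} {d : ℕ}
    {S : ℕ → Finset I} (hS : Monotone S) {T : Tiling G (S m → Fin (d + 1)) m F d} {ρ : ℝ}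
    (hT : T.IsAt ρ) {i : I} (hi : i ∈ S 0) (r : Fin m) (s : Fin (F r + 1))
    (v : S r → Fin (d + 1)) :
    CompBounded {x : I → G | x i ∈ T.D (T.label S x) r s ∧ ∀ j : S r, T.col (x j) = v j}
      (box (S (r + 1)) ρ) := by
  obtain ⟨cell, R, h1, h2⟩ := hT.col_bdd
  refine compBounded_box (R := R) hG hGi (fun j x => cell (x j)) (fun x hx y hy hxy => ?_)
    fun x _ y _ j _ => h2 _ _
  have hle : ∀ j ∈ S (r + 1), dist (x j) (y j) ≤ ρ := fun j hj => by
    rw [hGi.dist_eq]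
    exact hxy.2 j hj
  have hout : ∀ j ∉ S (r + 1), x j = y j := fun j hj => inv_mul_eq_one.1 (hxy.1 j hj)
  have hin : ∀ j ∈ S r, T.col (x j) = T.col (y j) := fun j hj =>
    (hx.2 ⟨j, hj⟩).trans (hy.2 ⟨j, hj⟩).symm
  have hlab : T.label S y = update (T.label S x) r (T.label S y r) := by
    ext1 q
    by_cases hq : q = r
    · subst hq
      simp
    · rw [update_of_ne hq]
      refine T.label_congr fun j hj hj' => ?_
      rcases lt_or_gt_of_ne (Fin.val_ne_of_ne hq) with hlt | hlt
      · exact (hin j (hS (by omega) hj)).symm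
      · rw [hout j fun hj'' => hj' (hS (by omega) hj'')]
  have heq : T.label S x r = T.label S y r := by
    refine hT.label_eq (T.label S x) r s _ _ (x i) (y i) ?_ ?_ (hle i (hS (Nat.zero_le _) hi))
    · rw [update_eq_self]
      exact hx.1
    · rw [← hlab]
      exact hy.1
  intro j hj
  refine h1 _ _ ?_ (hle j hj)
  by_cases hjr : j ∈ S r
  · exact hin j hjr
  · have := congrFun heq ⟨j, hS (by omega) hj⟩
    simpa [Tiling.label, hj, hjr] using this

theorem Tiling.compBounded_core {G I : Type*} [Group G] [MetricSpace G]
    (hG : ProperMet G) (hGi : LeftInvariant G) {m : ℕ} {F : Fin m → ℕ} {d : ℕ}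
    {S : ℕ → Finset I} (hS : Monotone S) {ρ : ℝ}
    (T : S 0 → Tiling G (S m → Fin (d + 1)) m F d) (hT : ∀ i, (T i).IsAt ρ) :
    CompBounded {x : I → G | ∀ i : S 0, x i ∈ (T i).C ((T i).label S x)} (box (S 0) ρ) := by
  classical
  choose cell R h1 h2 using fun i => (hT i).core_bdd
  obtain ⟨R', hR'⟩ := Finite.exists_le R
  refine compBounded_box (R := R') hG hGi
    (fun j x => if h : j ∈ S 0 then ((T ⟨j, h⟩).label S x,
      cell ⟨j, h⟩ ((T ⟨j, h⟩).label S x) (x j)) else ((fun _ _ => 0), ∅))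
    (fun x hx y hy hxy j hj => ?_) fun x hx y hy j hj hc => ?_
  · have hlab : (T ⟨j, hj⟩).label S x = (T ⟨j, hj⟩).label S y := by
      ext1 q
      refine (T ⟨j, hj⟩).label_congr fun i _ hi => ?_
      rw [inv_mul_eq_one.1 (hxy.1 i fun h => hi (hS (Nat.zero_le _) h))]
    simp only [hj, dif_pos, hlab, Prod.mk.injEq, true_and]
    refine h1 ⟨j, hj⟩ _ _ (hlab ▸ hx ⟨j, hj⟩) _ (hy ⟨j, hj⟩) ?_
    rw [hGi.dist_eq]
    exact hxy.2 j hj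
  · simp only [hj, dif_pos, Prod.mk.injEq] at hc
    refine (h2 ⟨j, hj⟩ _ _ (hx ⟨j, hj⟩) _ (hc.1 ▸ hy ⟨j, hj⟩) ?_).trans (hR' ⟨j, hj⟩)
    rw [hc.2, hc.1]

/-- A colouring of `H` with a choice `u` of representatives of the cells, together with a bound
`b` and a finite set `S` of coordinates. -/
structure Level (H I : Type*) [MetricSpace H] (n : ℕ) where
  /-- the representative of the cell of a point -/
  u : H → H
  /-- the colour of a point -/
  α : H → Fin (n + 1)
  /-- a bound on the distance to the representatives -/
  β : ℝ
  /-- a bound on the distance to the representatives after applying the section -/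
  b : ℝ
  /-- the set of coordinates seen at this scale -/
  S : Finset I
  dist_u_le : ∀ h, dist (u h) h ≤ β

/-- The second level is a coarsening of the first one, adapted to the scale `k`. -/
structure Level.IsNext {G H W I : Type*} [Group G] [Group H] [Group W] [MetricSpace H]
    [MetricSpace W] {n : ℕ} {ε : W →* H} (η : H → W) (ψ : ε.ker →* (I → G)) (k : ℝ)
    (L L' : Level H I n) : Prop where
  factor : ∀ h h', L.u h = L.u h' → L'.u h = L'.u h'
  dist_le : ∀ h, dist (η (L'.u h)) (η h) ≤ L'.b
  b_le : L.b ≤ L'.b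
  S_subset : L.S ⊆ L'.S
  u_eq : ∀ w w', dist w w' < k → L'.α (ε w) = L'.α (ε w') → L'.u (ε w) = L'.u (ε w')
  supp : ∀ x : ε.ker, dist 1 (x : W) ≤ k + 6 * L'.b → ∀ i ∉ L'.S, ψ x i = 1

theorem ProperMet.finite_ker {W H : Type*} [Group W] [Group H] [MetricSpace W]
    (hW : ProperMet W) (ε : W →* H) (R : ℝ) : {x : ε.ker | dist 1 (x : W) ≤ R}.Finite :=
  (hW.finite_dist_one_le R).preimage Subtype.val_injective.injOn

theorem Level.exists_isNext {G H W I : Type*} [Group G] [Group H] [Group W] [MetricSpace H]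
    [MetricSpace W] {n : ℕ} {ε : W →* H} {η : H → W} {ψ : ε.ker →* (I → G)}
    (hW : LeftInvariant W) (hWp : ProperMet W) (hH : LeftInvariant H) (hHn : AsdimLE H n)
    (hη : Bornologous η) (hψ : ∀ x, (mulSupport (ψ x)).Finite) (k : ℝ) (L : Level H I n) :
    ∃ L' : Level H I n, IsNext η ψ k L L' := by
  classical
  obtain ⟨c, hc0, hc⟩ := exists_map_dist_le hW hWp hH ε k
  obtain ⟨col, cell, R, h1, h2⟩ := hHn.exists_coloring (c + 2 * L.β)
  let p : H → H := fun h => invFun cell (cell h)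
  have hp : ∀ h, cell (p h) = cell h := fun h => invFun_eq ⟨h, rfl⟩
  have hβ : ∀ h, dist (p (L.u h)) h ≤ R + L.β := fun h =>
    (dist_triangle _ (L.u h) _).trans (add_le_add (h2 _ _ (hp _)) (L.dist_u_le h))
  have hβ0 : 0 ≤ R + L.β := dist_nonneg.trans (hβ 1)
  obtain ⟨P, -, hP⟩ := hη (R + L.β + 1) (by linarith)
  let b := max P L.b
  have hfin : (⋃ x ∈ {x : ε.ker | dist 1 (x : W) ≤ k + 6 * b}, mulSupport (ψ x)).Finite :=
    (hWp.finite_ker ε _).biUnion fun x _ => hψ x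
  refine ⟨⟨fun h => p (L.u h), fun h => col (L.u h), R + L.β, b, hfin.toFinset ∪ L.S, hβ⟩,
    fun h h' hh => congrArg p hh, fun h => ?_, le_max_right _ _, Finset.subset_union_right,
    fun w w' hd ha => ?_, fun x hx i hi => ?_⟩
  · exact (hP _ _ ((hβ h).trans_lt (by linarith))).le.trans (le_max_left _ _)
  · refine congrArg (invFun cell) (h1 _ _ ha ?_)
    have h3 := dist_triangle4 (L.u (ε w)) (ε w) (ε w') (L.u (ε w'))
    have h4 := L.dist_u_le (ε w)
    have h5 := L.dist_u_le (ε w')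
    rw [dist_comm] at h5
    linarith [hc w w' hd]
  · by_contra hne
    refine hi (Finset.mem_union_left _ (hfin.mem_toFinset.2 (Set.mem_iUnion₂.2 ⟨x, hx, hne⟩)))

/-- The components of `E` at scale `k` have bounded diameter. -/
def ChainBounded {W : Type*} [MetricSpace W] (k : ℝ) (E : Set W) : Prop :=
  ∃ R : ℝ, ∀ x y, Relation.ReflTransGen (fun x y => x ∈ E ∧ y ∈ E ∧ dist x y < k) x y →
    dist x y ≤ R

/-- The kernel coordinate of `w` with respect to the section `η` and the representatives `u`. -/
def kerPart {H W : Type*} [Group H] [Group W] {ε : W →* H} {η : H → W}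
    (hs : ∀ h, ε (η h) = h) (u : H → H) (w : W) : ε.ker :=
  ⟨(η (u (ε w)))⁻¹ * (w * (η (ε w))⁻¹) * η (u (ε w)), by simp [MonoidHom.mem_ker, hs]⟩

theorem chainBounded_of_compBounded {H W Z : Type*} [Group H] [Group W] [MetricSpace W]
    (hW : LeftInvariant W) [Finite Z] {ε : W →* H} {η : H → W} (hs : ∀ h, ε (η h) = h)
    {u : H → H} {b k : ℝ} (hb : ∀ h, dist (η (u h)) (η h) ≤ b) {E : Set W} (f : W → Z)
    (hE : ∀ w ∈ E, ∀ w' ∈ E, dist w w' < k → u (ε w) = u (ε w') ∧ f w = f w')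
    {A : Z → Set ε.ker} (hA : ∀ w ∈ E, kerPart hs u w ∈ A (f w))
    (hAb : ∀ z, CompBounded (A z) {x : ε.ker | dist 1 (x : W) ≤ k + 2 * b}) :
    ChainBounded k E := by
  choose Q hQ hAQ using hAb
  obtain ⟨R, hR⟩ := ((Set.finite_iUnion hQ).image fun x : ε.ker => dist 1 (x : W)).bddAbove
  have hb' : ∀ h, dist 1 ((η h)⁻¹ * η (u h)) ≤ b := fun h => by
    rw [← hW.dist_eq, dist_comm]
    exact hb h
  have hb'' : ∀ h, dist 1 ((η (u h))⁻¹ * η h) ≤ b := fun h => by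
    rw [← hW.dist_eq]
    exact hb h
  refine ⟨max 0 (R + 2 * b), fun x y h => ?_⟩
  have key : x = y ∨ x ∈ E ∧ y ∈ E ∧ u (ε x) = u (ε y) ∧ f x = f y ∧
      Relation.ReflTransGen (IsStep (A (f x)) {x : ε.ker | dist 1 (x : W) ≤ k + 2 * b})
        (kerPart hs u x) (kerPart hs u y) := by
    have step : ∀ y z, y ∈ E ∧ z ∈ E ∧ dist y z < k →
        IsStep (A (f y)) {x : ε.ker | dist 1 (x : W) ≤ k + 2 * b} (kerPart hs u y)
          (kerPart hs u z) := by
      rintro y z ⟨hy, hz, hyz⟩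
      obtain ⟨h1, h2⟩ := hE y hy z hz hyz
      refine ⟨hA y hy, h2 ▸ hA z hz, ?_⟩
      have heq : ((kerPart hs u y)⁻¹ * kerPart hs u z : ε.ker) =
          ((η (u (ε y)))⁻¹ * η (ε y)) * ((y⁻¹ * z) * ((η (ε z))⁻¹ * η (u (ε z)))) := by
        simp only [kerPart, h1, Subgroup.coe_mul, Subgroup.coe_inv]
        group
      rw [Set.mem_ofPred_eq, heq]
      have h3 := hW.dist_one_mul_le ((η (u (ε y)))⁻¹ * η (ε y))
        ((y⁻¹ * z) * ((η (ε z))⁻¹ * η (u (ε z))))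
      have h4 := hW.dist_one_mul_le (y⁻¹ * z) ((η (ε z))⁻¹ * η (u (ε z)))
      rw [hW.dist_eq] at hyz
      linarith [hb' (ε z), hb'' (ε y)]
    induction h with
    | refl => exact Or.inl rfl
    | @tail y z _ hyz ih =>
      have hst := step y z hyz
      obtain ⟨h1, h2⟩ := hE y hyz.1 z hyz.2.1 hyz.2.2
      rcases ih with rfl | ⟨hx, _, h3, h4, h5⟩
      · exact Or.inr ⟨hyz.1, hyz.2.1, h1, h2, .single hst⟩
      · exact Or.inr ⟨hx, hyz.2.1, h3.trans h1, h4.trans h2, h5.tail (h4 ▸ hst)⟩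
  rcases key with rfl | ⟨_, _, h1, _, h2⟩
  · simp
  · refine le_max_of_le_right ?_
    have heq : x⁻¹ * y = ((η (ε x))⁻¹ * η (u (ε x))) *
        (((kerPart hs u x)⁻¹ * kerPart hs u y : ε.ker) * ((η (u (ε y)))⁻¹ * η (ε y))) := by
      simp only [kerPart, h1, Subgroup.coe_mul, Subgroup.coe_inv]
      group
    rw [hW.dist_eq, heq]
    have h3 := hW.dist_one_mul_le ((η (ε x))⁻¹ * η (u (ε x)))
      (((kerPart hs u x)⁻¹ * kerPart hs u y : ε.ker) * ((η (u (ε y)))⁻¹ * η (ε y)))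
    have h4 := hW.dist_one_mul_le ((kerPart hs u x)⁻¹ * kerPart hs u y : ε.ker)
      ((η (u (ε y)))⁻¹ * η (ε y))
    have h5 : dist 1 (((kerPart hs u x)⁻¹ * kerPart hs u y : ε.ker) : W) ≤ R :=
      hR ⟨_, Set.mem_iUnion.2 ⟨_, hAQ _ _ _ h2⟩, rfl⟩
    linarith [hb' (ε x), hb'' (ε y)]

/-- The elements of `Γ` all of whose images under the homomorphisms `f τ`, `τ ∈ A`, are supported
in `S`. -/
def suppSubgroup {Γ I G Θ : Type*} [Group Γ] [Group G] (f : Θ → Γ →* (I → G)) (A : Set Θ)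
    (S : Finset I) : Subgroup Γ :=
  ⨅ τ ∈ A, ⨅ j ∉ S, ((Pi.evalMonoidHom (fun _ => G) j).comp (f τ)).ker

theorem mem_suppSubgroup {Γ I G Θ : Type*} [Group Γ] [Group G] {f : Θ → Γ →* (I → G)}
    {A : Set Θ} {S : Finset I} {x : Γ} :
    x ∈ suppSubgroup f A S ↔ ∀ τ ∈ A, ∀ j ∉ S, f τ x j = 1 := by
  simp [suppSubgroup, Subgroup.mem_iInf, MonoidHom.mem_ker]

/-- The homomorphism `ψ` on the kernel, twisted by conjugation by `τ⁻¹`. -/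
def conjHom {G H W I : Type*} [Group G] [Group H] [Group W] {ε : W →* H}
    (ψ : ε.ker →* (I → G)) (τ : W) : ε.ker →* (I → G) :=
  ψ.comp (MulAut.conjNormal τ⁻¹ : ε.ker ≃* ε.ker).toMonoidHom

theorem conjHom_apply {G H W I : Type*} [Group G] [Group H] [Group W] {ε : W →* H}
    (ψ : ε.ker →* (I → G)) (τ : W) (x y : ε.ker) (h : (y : W) = τ⁻¹ * x * τ) :
    conjHom ψ τ x = ψ y := by
  refine congrArg ψ (Subtype.ext ?_)
  rw [h]
  change ((MulAut.conjNormal τ⁻¹ x : ε.ker) : W) = _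
  rw [MulAut.conjNormal_apply, inv_inv]

theorem conjHom_injective {G H W I : Type*} [Group G] [Group H] [Group W] {ε : W →* H}
    {ψ : ε.ker →* (I → G)} (hψ : Injective ψ) (τ : W) : Injective (conjHom ψ τ) :=
  hψ.comp (MulAut.conjNormal τ⁻¹ : ε.ker ≃* ε.ker).injective

theorem exists_chainBounded_cover {G H W I : Type*} [Group G] [Group H] [Group W]
    [MetricSpace G] [MetricSpace H] [MetricSpace W] (hG : LeftInvariant G) (hGp : ProperMet G)
    (hW : LeftInvariant W) (hWp : ProperMet W) {n m d : ℕ} {F : Fin m → ℕ} {ε : W →* H}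
    {η : H → W} (hs : ∀ h, ε (η h) = h) {ψ : ε.ker →* (I → G)} (hψ : Injective ψ) {k : ℕ → ℝ}
    {Lv : ℕ → Level H I n} (hL : ∀ q, (Lv q).IsNext η ψ (k q) (Lv (q + 1)))
    (hF : ∀ ρ, ∃ T : Tiling G ((Lv (m + 1)).S → Fin (d + 1)) m F d, T.IsAt ρ) :
    ∃ (E₀ : Fin (n + 1) → Set W)
      (E : (r : Fin m) → Fin (n + 1) × Fin (F r + 1) × ((Lv (r + 1)).S → Fin (d + 1)) → Set W),
      (∀ w, (∃ a, w ∈ E₀ a) ∨ ∃ r c, w ∈ E r c) ∧ (∀ a, ChainBounded (k 0) (E₀ a)) ∧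
      ∀ (r : Fin m) c, ChainBounded (k (r + 1)) (E r c) := by
  let S : ℕ → Finset I := fun q => (Lv (q + 1)).S
  let b : ℕ → ℝ := fun q => (Lv (q + 1)).b
  let u : ℕ → H → H := fun q => (Lv (q + 1)).u
  have hS : Monotone S := monotone_nat_of_le_succ fun q => (hL (q + 1)).S_subset
  have hb : Monotone b := monotone_nat_of_le_succ fun q => (hL (q + 1)).b_le
  have hub : ∀ q h, dist (η (u q h)) (η h) ≤ b q := fun q => (hL q).dist_le
  have hb0 : ∀ q, 0 ≤ b q := fun q => dist_nonneg.trans (hub q (1 : H))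
  have hu : ∀ q h h', u 0 h = u 0 h' → u q h = u q h' := by
    intro q
    induction q with
    | zero => exact fun _ _ => id
    | succ q ih => exact fun h h' hh => (hL (q + 1)).factor _ _ (ih h h' hh)
  let κ : ℕ → W → ε.ker := fun q => kerPart hs (u q)
  let Z := {e : Fin m → W // ∀ r : Fin m, e r ∈ {τ : W | dist 1 τ ≤ 2 * b (r + 1)}}
  have : Finite Z := Set.Finite.to_subtype
    (Set.Finite.pi' fun r : Fin m => hWp.finite_dist_one_le (2 * b (r + 1)))
  let z : W → Z := fun w => ⟨fun r => (η (u (r + 1) (ε w)))⁻¹ * η (u 0 (ε w)), fun r => by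
    rw [Set.mem_ofPred_eq, ← hW.dist_eq]
    have h1 := dist_triangle_right (η (u (r + 1) (ε w))) (η (u 0 (ε w))) (η (ε w))
    linarith [hub (r + 1) (ε w), hub 0 (ε w), hb (Nat.zero_le (r + 1 : ℕ))]⟩
  have hz : ∀ w r, conjHom ψ ((z w).1 r) (κ (r + 1) w) = ψ (κ 0 w) := fun w r =>
    conjHom_apply _ _ _ _ (by simp only [κ, z, kerPart]; group)
  let Y := Σ r : Fin m, Fin (F r + 1) × (S r → Fin (d + 1))
  let P : Y → Set ε.ker := fun y => {x | dist 1 (x : W) ≤ k (y.1 + 1) + 2 * b (y.1 + 1)}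
  let Sg : Y → Subgroup ε.ker := fun y =>
    suppSubgroup (conjHom ψ) {τ : W | dist 1 τ ≤ 2 * b (y.1 + 1)} (S (y.1 + 1))
  have hPS : ∀ y, P y ⊆ Sg y := by
    intro y x hx
    refine mem_suppSubgroup.2 fun τ hτ j hj => ?_
    rw [conjHom_apply ψ τ x ⟨τ⁻¹ * x * τ, by
      simp [MonoidHom.mem_ker, MonoidHom.mem_ker.1 x.2]⟩ rfl]
    refine (hL (y.1 + 1)).supp _ ?_ j hj
    have h1 := hW.dist_one_mul_le (τ⁻¹ * x) τ
    have h2 := hW.dist_one_mul_le τ⁻¹ x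
    rw [hW.dist_one_inv] at h2
    change dist 1 (x : W) ≤ k (y.1 + 1) + 2 * b (y.1 + 1) at hx
    change dist 1 τ ≤ 2 * b (y.1 + 1) at hτ
    change dist 1 (τ⁻¹ * x * τ) ≤ k (y.1 + 1) + 6 * b (y.1 + 1)
    linarith
  have hP₀ := hWp.finite_ker ε (k 0 + 2 * b 0)
  obtain ⟨ρ₀, hρ₀⟩ := exists_subset_box ψ hP₀ (S 0) fun x hx => (hL 0).supp x (by
    change dist 1 (x : W) ≤ k 0 + 2 * b 0 at hx
    change dist 1 (x : W) ≤ k 0 + 6 * b 0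
    linarith [hb0 0])
  obtain ⟨T, hT₀, hT⟩ := exists_compBounded_iUnion (Λ := Z × S 0)
    (𝒯 := Tiling G (S m → Fin (d + 1)) m F d) Sg P (fun y => hWp.finite_ker ε _) hPS
    (fun i T y => conjHom ψ (i.1.1 y.1) ⁻¹'
      {x | x i.2 ∈ T.D (T.label S x) y.1 y.2.1 ∧ ∀ j : S y.1, T.col (x j) = y.2.2 j})
    (fun _ T => T.IsAt ρ₀) (by
      rintro ⟨e, i⟩ P' hP' hPS'
      choose ρ hρ using fun y => exists_subset_box (conjHom ψ (e.1 y.1)) (hP' y) (S (y.1 + 1))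
        fun x hx => mem_suppSubgroup.1 (hPS' y hx) _ (e.2 y.1)
      obtain ⟨ρ', hρ'⟩ := Finite.exists_le ρ
      obtain ⟨T, hT⟩ := hF (max ρ' ρ₀)
      refine ⟨T, hT.mono (le_max_right _ _), fun y => ?_⟩
      exact ((hT.mono ((hρ' y).trans (le_max_left _ _))).compBounded_translated hGp hG hS i.2
        y.1 y.2.1 y.2.2).comap _ (conjHom_injective hψ _) (hρ y))
  refine ⟨fun a => {w | (Lv 1).α (ε w) = a ∧ κ 0 w ∈ ψ ⁻¹'
      {x | ∀ i : S 0, x i ∈ (T (z w, i)).C ((T (z w, i)).label S x)}},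
    fun r c => {w | (Lv (r + 1 + 1)).α (ε w) = c.1 ∧ ∃ i : S 0,
      ψ (κ 0 w) ∈ {x : I → G | x i ∈ (T (z w, i)).D ((T (z w, i)).label S x) r c.2.1 ∧
        ∀ j : S r, (T (z w, i)).col (x j) = c.2.2 j}}, fun w => ?_, fun a => ?_, fun r c => ?_⟩
  · by_cases h : ∀ i : S 0, ψ (κ 0 w) i ∈ (T (z w, i)).C ((T (z w, i)).label S (ψ (κ 0 w)))
    · exact Or.inl ⟨_, rfl, h⟩
    · push Not at h
      obtain ⟨i, hi⟩ := h
      obtain ⟨r, s, hrs⟩ := ((hT₀ (z w, i)).cover _ _).resolve_left hi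
      exact Or.inr ⟨r, ⟨_, s, fun j => (T (z w, i)).col (ψ (κ 0 w) j)⟩, rfl, i, hrs,
        fun _ => rfl⟩
  · refine chainBounded_of_compBounded hW hs (hub 0) z (fun w hw w' hw' hd => ?_)
      (A := fun e => ψ ⁻¹' {x | ∀ i : S 0, x i ∈ (T (e, i)).C ((T (e, i)).label S x)})
      (fun w hw => hw.2) fun e => ?_
    · have h1 : u 0 (ε w) = u 0 (ε w') := (hL 0).u_eq w w' hd (hw.1.trans hw'.1.symm)
      refine ⟨h1, Subtype.ext (funext fun r => ?_)⟩
      simp only [z, h1, hu (r + 1) _ _ h1]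
    · exact (Tiling.compBounded_core hGp hG hS (fun i => T (e, i)) fun i => hT₀ _).comap ψ hψ hρ₀
  · refine chainBounded_of_compBounded hW hs (hub (r + 1)) (fun _ => ())
      (fun w hw w' hw' hd => ⟨(hL (r + 1)).u_eq w w' hd (hw.1.trans hw'.1.symm), rfl⟩)
      (fun w hw => ?_) fun _ => hT ⟨r, c.2⟩
    obtain ⟨-, i, hi⟩ := hw
    rw [← hz w r] at hi
    exact Set.mem_iUnion.2 ⟨(z w, i), hi⟩

theorem ChainBounded.mono {W : Type*} [MetricSpace W] {k k' : ℝ} {E : Set W}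
    (h : ChainBounded k E) (hk : k' ≤ k) : ChainBounded k' E := by
  obtain ⟨R, h⟩ := h
  exact ⟨R, fun x y hxy => h x y
    (hxy.lift id fun a b hab => ⟨hab.1, hab.2.1, hab.2.2.trans_le hk⟩)⟩

theorem mem_aClass_of_subset {W : Type*} [MetricSpace W] {σ σ' : Finset ℕ} (h : σ ∈ AClass W)
    (hσ : σ' ⊆ σ) (hne : σ'.Nonempty) : σ' ∈ AClass W := by
  classical
  refine ⟨hne, fun ⟨𝒰, h1, h2, h3⟩ => h.2 ⟨fun i => if i ∈ σ' then 𝒰 i else ∅,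
    fun i _ => ?_, fun i _ => ?_, ?_⟩⟩
  · dsimp only
    split_ifs with hi
    · exact h1 i hi
    · exact ⟨1, one_pos, fun U hU => absurd hU (Set.notMem_empty U)⟩
  · dsimp only
    split_ifs with hi
    · exact h2 i hi
    · exact fun U hU => absurd hU (Set.notMem_empty U)
  · refine Set.eq_univ_of_forall fun x => ?_
    have hx := Set.mem_univ x
    rw [← h3] at hx
    obtain ⟨i, hi, hx⟩ := Set.mem_iUnion₂.1 hx
    refine Set.mem_iUnion₂.2 ⟨i, hσ hi, ?_⟩
    dsimp only
    rwa [if_pos hi]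

theorem notMem_aClass_of_chainBounded {W ι : Type*} [MetricSpace W] (E : ι → Set W) (g : ι → ℕ)
    (hg : Injective g) (hcov : ∀ w, ∃ i, w ∈ E i) (hE : ∀ i, ChainBounded (g i) (E i))
    {σ : Finset ℕ} (hσ : ∀ i, g i ∈ σ) : σ ∉ AClass W := by
  rintro ⟨-, h⟩
  let step : ι → W → W → Prop := fun i x y => x ∈ E i ∧ y ∈ E i ∧ dist x y < g i
  let comp : ι → W → Set W := fun i x => {y | Relation.ReflTransGen (step i) x y}
  have hsymm : ∀ i x y, Relation.ReflTransGen (step i) x y →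
      Relation.ReflTransGen (step i) y x := by
    intro i x y hxy
    induction hxy with
    | refl => exact .refl
    | tail _ h ih => exact .head ⟨h.2.1, h.1, by rw [dist_comm]; exact h.2.2⟩ ih
  have hmem : ∀ i x y, x ∈ E i → Relation.ReflTransGen (step i) x y → y ∈ E i := by
    intro i x y hx hxy
    induction hxy with
    | refl => exact hx
    | tail _ h _ => exact h.2.1
  have hcomp : ∀ i x y, Relation.ReflTransGen (step i) x y → comp i x = comp i y :=
    fun i x y hxy => Set.ext fun z => ⟨(hsymm i x y hxy).trans, hxy.trans⟩
  refine h ⟨fun c => {U | ∃ i, g i = c ∧ ∃ x ∈ E i, U = comp i x}, fun c _ => ?_, fun c _ => ?_,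
    Set.eq_univ_of_forall fun x => ?_⟩
  · by_cases hc : ∃ i, g i = c
    · obtain ⟨i, rfl⟩ := hc
      obtain ⟨R, hR⟩ := hE i
      refine ⟨2 * |R| + 1, by positivity, ?_⟩
      rintro _ ⟨j, hj, x, -, rfl⟩ y hy y' hy'
      obtain rfl := hg hj
      have h1 := dist_triangle_left y y' x
      linarith [hR x y hy, hR x y' hy', le_abs_self R]
    · exact ⟨1, one_pos, fun U ⟨i, hi, _⟩ => absurd ⟨i, hi⟩ hc⟩
  · rintro _ ⟨i, rfl, x, hx, rfl⟩ _ ⟨j, hj, x', hx', rfl⟩ hne y hy y' hy'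
    obtain rfl := hg hj
    by_contra! hlt
    refine hne ?_
    rw [hcomp _ x y hy, hcomp _ x' y' hy']
    exact hcomp _ y y' (.single ⟨hmem _ x y hx hy, hmem _ x' y' hx' hy', hlt⟩)
  · obtain ⟨i, hi⟩ := hcov x
    exact Set.mem_iUnion₂.2 ⟨g i, hσ i, comp i x, ⟨i, rfl, x, hi, rfl⟩, .refl⟩

/-- Given families of sets indexed by `A` and `B r`, `r < m`, that are bounded at scales `k 0` and
`k (r + 1)`, blocks `τ 0` and `τ (r + 1)` of at least as many numbers suffice for a covering. -/
theorem notMem_aClass_of_blocks {W A : Type*} [MetricSpace W] [Finite A] {m : ℕ}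
    {B : Fin m → Type*} [∀ r, Finite (B r)] {k : ℕ → ℕ} {τ : ℕ → Finset ℕ}
    (E₀ : A → Set W) (E : ∀ r, B r → Set W) (hcov : ∀ w, (∃ a, w ∈ E₀ a) ∨ ∃ r c, w ∈ E r c)
    (h₀ : ∀ a, ChainBounded (k 0) (E₀ a))
    (h : ∀ (r : Fin m) c, ChainBounded (k (r + 1)) (E r c))
    (hτ₀ : Nat.card A ≤ (τ 0).card) (hτ : ∀ r : Fin m, Nat.card (B r) ≤ (τ (r + 1)).card)
    (hk : ∀ r ≤ m, ∀ a ∈ τ r, a ≤ k r) (hd : ∀ r ≤ m, ∀ q < r, Disjoint (τ q) (τ r)) :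
    (Finset.range (m + 1)).biUnion τ ∉ AClass W := by
  have := Fintype.ofFinite A
  have := fun r => Fintype.ofFinite (B r)
  simp only [Nat.card_eq_fintype_card] at hτ₀ hτ
  have f₀ : Nonempty (A ↪ τ 0) := Function.Embedding.nonempty_of_card_le (by simpa using hτ₀)
  have f : ∀ r : Fin m, Nonempty (B r ↪ τ (r + 1)) := fun r =>
    Function.Embedding.nonempty_of_card_le (by simpa using hτ r)
  replace f₀ := f₀.some
  replace f := fun r => (f r).some
  let g : A ⊕ (Σ r, B r) → ℕ := Sum.elim (fun a => f₀ a) fun c => f c.1 c.2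
  let s : A ⊕ (Σ r, B r) → ℕ := Sum.elim (fun _ => 0) fun c => c.1 + 1
  have hg : ∀ x, g x ∈ τ (s x) := by
    rintro (a | ⟨r, c⟩)
    · exact (f₀ a).2
    · exact (f r c).2
  have hs : ∀ x, s x ≤ m := by
    rintro (a | ⟨r, c⟩)
    · exact Nat.zero_le _
    · exact r.2
  have hgs : ∀ x y, g x = g y → s x = s y := by
    intro x y hxy
    rcases lt_trichotomy (s x) (s y) with hlt | heq | hlt
    · exact absurd (hxy ▸ hg y) (Finset.disjoint_left.1 (hd _ (hs y) _ hlt) (hg x))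
    · exact heq
    · exact absurd (hxy ▸ hg x) (Finset.disjoint_left.1 (hd _ (hs x) _ hlt) (hg y))
  refine notMem_aClass_of_chainBounded (Sum.elim E₀ fun c => E c.1 c.2) g ?_ (fun w => ?_) ?_
    fun x => Finset.mem_biUnion.2 ⟨s x, Finset.mem_range.2 (Nat.lt_succ_of_le (hs x)), hg x⟩
  · rintro (a | ⟨r, c⟩) (a' | ⟨r', c'⟩) hxy
    · exact congrArg Sum.inl (f₀.injective (Subtype.ext hxy))
    · exact absurd (hgs _ _ hxy) (Nat.succ_ne_zero _).symm
    · exact absurd (hgs _ _ hxy) (Nat.succ_ne_zero _)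
    · obtain rfl : r = r' := Fin.ext (Nat.succ_injective (hgs _ _ hxy))
      obtain rfl : c = c' := (f r).injective (Subtype.ext hxy)
      rfl
  · rcases hcov w with ⟨a, ha⟩ | ⟨r, c, hc⟩
    · exact ⟨Sum.inl a, ha⟩
    · exact ⟨Sum.inr ⟨r, c⟩, hc⟩
  · have hle : ∀ x, (g x : ℝ) ≤ k (s x) := fun x => Nat.cast_le.2 (hk _ (hs x) _ (hg x))
    rintro (a | ⟨r, c⟩)
    · exact (h₀ a).mono (hle _)
    · exact (h r c).mono (hle (Sum.inr ⟨r, c⟩))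

theorem trasdimLE_of_extension {G H W I : Type*} [Group G] [Group H] [Group W]
    [MetricSpace G] [MetricSpace H] [MetricSpace W] (hGp : ProperMet G) (hG : LeftInvariant G)
    (hH : LeftInvariant H) (hWp : ProperMet W) (hW : LeftInvariant W) {m n : ℕ}
    (hGfad : HasFiniteAsdim G) (hGdtut : DTUT G m 0) (hHn : AsdimLE H n) {ε : W →* H}
    {η : H → W} (hs : ∀ h, ε (η h) = h) (hη : Bornologous η) {ψ : ε.ker →* (I → G)}
    (hψ : Injective ψ) (hψf : ∀ x, (mulSupport (ψ x)).Finite) :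
    TrasdimLE W (Ordinal.omega0 * (m : Ordinal.{0}) + (n : Ordinal.{0})) := by
  obtain ⟨d, hd⟩ := hGfad
  obtain ⟨F, hF⟩ := hGdtut.exists_tiling hd
  choose next hnext using Level.exists_isNext (n := n) (ε := ε) (η := η) (ψ := ψ) hW hWp hH hHn
    hη hψf
  let Lv : (ℕ → ℕ) → ℕ → Level H I n := fun k r =>
    Nat.rec ⟨id, fun _ => 0, 0, 0, ∅, fun h => (dist_self h).le⟩ (fun q L => next (k q) L) r
  have hLv : ∀ k k' r, (∀ q < r, k q = k' q) → Lv k r = Lv k' r := by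
    intro k k' r
    induction r with
    | zero => exact fun _ => rfl
    | succ r ih =>
      intro h
      change next (k r) (Lv k r) = next (k' r) (Lv k' r)
      rw [h r r.lt_succ_self, ih fun q hq => h q (hq.trans r.lt_succ_self)]
  let N : (ℕ → ℕ) → ℕ → ℕ := fun k r => match r with
    | 0 => n
    | r + 1 => if h : r < m then
        Nat.card (Fin (n + 1) × Fin (F ⟨r, h⟩ + 1) × ((Lv k (r + 1)).S → Fin (d + 1))) else 0
  refine ordLE_of_blocks (fun σ hσ σ' h hne => mem_aClass_of_subset hσ h hne) (fun σ hσ => hσ.1)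
    m n N (fun _ => rfl) (fun k k' r h => ?_) fun k τ hτ hdis => ?_
  · cases r with
    | zero => rfl
    | succ r => simp only [N, hLv k k' (r + 1) h]
  · obtain ⟨E₀, E, hcov, h₀, h⟩ := exists_chainBounded_cover hG hGp hW hWp (m := m) (d := d)
      (F := F) hs hψ (k := fun q => k q) (Lv := Lv k) (fun q => hnext (k q) (Lv k q))
      fun ρ => hF _ ρ
    refine notMem_aClass_of_blocks E₀ E hcov h₀ h ?_ (fun r => ?_) (fun r hr => (hτ r hr).2) hdis
    · rw [(hτ 0 (Nat.zero_le m)).1, Nat.card_fin]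
    · rw [(hτ (r + 1) r.2).1]
      simp only [N, r.2, dif_pos, Fin.eta]
      exact Nat.le_succ _

end APC

open APC Set

/-- Let `G`, `H` be countable discrete groups with proper left-invariant
metrics, where `G` has finite asymptotic dimension and the `(m,0)`-DTUT property, and `H`
is an FC-group with `asdim H ≤ n < ∞`.  Let `W` be a wreath-like product of `G` and `H`
corresponding to an action `H ↷ I` with finitely many orbits, and suppose there is a
symmetric transversal `T` for `⊕_{i ∈ I} G` in `W` whose transversal map `η : H → T` is
unital and bornologous.  Then `W`, equipped with a proper left-invariant metric associated
with `T`, satisfies `trasdim W ≤ ω·m + asdim H`. -/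
theorem wreath_like_product_trasdim_le
    {G H W I : Type*} [Group G] [Group H] [Group W]
    [Countable G] [Countable H]
    [MetricSpace G] [MetricSpace H] [MetricSpace W]
    [MulAction H I]
    -- the metrics on `G` and `H` are proper and left-invariant
    (hGproper : ProperMet G) (hGinv : LeftInvariant G)
    (hHproper : ProperMet H) (hHinv : LeftInvariant H)
    -- `G` has finite asymptotic dimension and the `(m,0)`-DTUT property
    (m : ℕ) (hGfad : HasFiniteAsdim G) (hGdtut : DTUT G m 0)
    -- `H` is an FC-group with finite asymptotic dimension `asdim H ≤ n`
    (hHFC : IsFCGroup H) (n : ℕ) (hHasdim : AsdimLE H n)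
    -- the action `H ↷ I` has finitely many orbits
    (horb : Finite (MulAction.orbitRel.Quotient H I))
    -- `W` is a wreath-like product: an extension `1 → ⊕_{i∈I} G → W → H → 1` in which
    -- conjugation by `w ∈ W` maps the factor `G_i` onto the factor `G_{ε(w)•i}`
    (ε : W →* H) (hsurj : Function.Surjective ε)
    (φ : ε.ker ≃* finSuppSubgroup I G)
    (hconj : ∀ (w : W) (i : I),
      (fun x => w * x * w⁻¹) ''
          {x : W | ∃ hx : x ∈ ε.ker, Function.mulSupport ((φ ⟨x, hx⟩ : I → G)) ⊆ {i}} =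
        {x : W | ∃ hx : x ∈ ε.ker, Function.mulSupport ((φ ⟨x, hx⟩ : I → G)) ⊆ {ε w • i}})
    -- `T` is a symmetric transversal for `ker ε = ⊕_{i∈I} G` in `W`
    (T : Set W) (hT1 : (1 : W) ∈ T) (hTsymm : ∀ t ∈ T, t⁻¹ ∈ T)
    (hTtransversal : ∀ h : H, ∃! t : W, t ∈ T ∧ ε t = h)
    -- the transversal map `η : H → T` is unital and bornologous
    (η : H → W) (hηT : ∀ h : H, η h ∈ T) (hηsec : ∀ h : H, ε (η h) = h)
    (hηunital : η 1 = 1) (hηborn : Bornologous η)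
    -- a choice of base point `i_{α,0}` in each orbit of `H ↷ I`
    (rep : MulAction.orbitRel.Quotient H I → I)
    (hrep : ∀ α, Quotient.mk (MulAction.orbitRel H I) (rep α) = α)
    -- `d_W` is a proper left-invariant metric on `W` associated with `T`: the weighted
    -- word metric for the generating set consisting of the δ-functions supported at the
    -- orbit representatives (weighted by the length of their value in `G`) together with
    -- the transversal elements `η h` (weighted by the length of `h` in `H`)
    (hWproper : ProperMet W) (hWinv : LeftInvariant W)
    (hWdist : ∀ u v : W, dist u v =
      sInf {c : ℝ | ∃ L : List (W × ℝ),
        (∀ p ∈ L,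
          (∃ hp : p.1 ∈ ε.ker, ∃ α : MulAction.orbitRel.Quotient H I,
              Function.mulSupport ((φ ⟨p.1, hp⟩ : I → G)) ⊆ {rep α} ∧
              p.2 = dist (1 : G) ((φ ⟨p.1, hp⟩ : I → G) (rep α))) ∨
          (∃ h : H, p.1 = η h ∧ p.2 = dist (1 : H) h)) ∧
        (L.map Prod.fst).prod = u⁻¹ * v ∧ (L.map Prod.snd).sum = c}) :
    TrasdimLE W (Ordinal.omega0 * (m : Ordinal.{0}) + (n : Ordinal.{0})) := by
  refine trasdimLE_of_extension hGproper hGinv hHinv hWproper hWinv hGfad hGdtut hHasdim hηsec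
    hηborn (ψ := (finSuppSubgroup I G).subtype.comp φ.toMonoidHom) ?_ fun x => (φ x).2
  exact Subtype.val_injective.comp φ.injective
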